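/- arXiv:1208.3732 — 2 statements merged into one kernel-verified Lean document; each statement's English description precedes it below -/
import Mathlib

section
/- Let N ≥ 4 be a real number, λ > 0, and let f be an entire function (a power series with infinite radius of convergence). Suppose y : (0,1] → ℝ is twice continuously differentiable, satisfies −λ·y(z) − (z·y''(z) + (N/2)·y'(z)) = f(z) for all z ∈ (0,1), and ∫₀¹ |y(z)|² z^{N/2−1} dz < ∞. Then y is the restriction of an entire function: there exists a power series Y(z) = ∑_{k=0}^∞ a_k z^k with infinite radius of convergence such that Y(z) = y(z) for all z ∈ (0,1]. -/
open MeasureTheory Real Set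

noncomputable section

/-- The degenerate operator `Δy(z) = z y''(z) + (N/2) y'(z)`. -/
def Del (N : ℝ) (f : ℝ → ℝ) : ℝ → ℝ :=
  fun z => z * deriv (deriv f) z + (N / 2) * deriv f z

/-- Iterates `Δ^m`. -/
def DelIter (N : ℝ) : ℕ → (ℝ → ℝ) → ℝ → ℝ
  | 0 => fun f => f
  | m + 1 => fun f => Del N (DelIter N m f)

/-- `Ḋ = √z d/dz`. -/
def Ddot (f : ℝ → ℝ) : ℝ → ℝ := fun z => Real.sqrt z * deriv f z

/-- The weighted L² norm on (0,1). -/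
def Xnorm (N : ℝ) (f : ℝ → ℝ) : ℝ :=
  Real.sqrt (∫ z in (0:ℝ)..1, (f z) ^ 2 * z ^ (N / 2 - 1))

/-- Graded seminorms `(y)_ℓ`. -/
def gnorm (N : ℝ) (ℓ : ℕ) (f : ℝ → ℝ) : ℝ :=
  if ℓ % 2 = 0 then Xnorm N (DelIter N (ℓ / 2) f)
  else Xnorm N (Ddot (DelIter N (ℓ / 2) f))

/-- Graded norm `‖y‖_n`. -/
def normN (N : ℝ) (n : ℕ) (f : ℝ → ℝ) : ℝ :=
  Real.sqrt (∑ ℓ ∈ Finset.range (n + 1), (gnorm N ℓ f) ^ 2)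

/-- Sup norm on [0,1]. -/
def supN (f : ℝ → ℝ) : ℝ := ⨆ z : Icc (0:ℝ) 1, |f z.1|

/-- `|y|_n = ∑_{ℓ≤n} ‖Ḋ^ℓ y‖_{L^∞(0,1)}`. -/
def supLow (n : ℕ) (f : ℝ → ℝ) : ℝ := ∑ ℓ ∈ Finset.range (n + 1), supN (Ddot^[ℓ] f)

/-- Time derivative of a function of (t,z). -/
def dt (y : ℝ → ℝ → ℝ) : ℝ → ℝ → ℝ := fun t z => deriv (fun s => y s z) t

/-- Sup norm on [0,T]×[0,1]. -/
def supT (T : ℝ) (y : ℝ → ℝ → ℝ) : ℝ :=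
  ⨆ (t : Icc (0:ℝ) T) (z : Icc (0:ℝ) 1), |y t.1 z.1|

/-- `|y|_n^T = sup_{j+k≤n} ‖∂_t^j Ḋ^k y‖_{L^∞([0,T]×[0,1])}`. -/
def supNT (T : ℝ) (n : ℕ) (y : ℝ → ℝ → ℝ) : ℝ :=
  ⨆ p : {p : ℕ × ℕ // p.1 + p.2 ≤ n}, supT T (fun t => Ddot^[p.1.2] (dt^[p.1.1] y t))

/-- `‖y‖_n^T`. -/
def normT (N T : ℝ) (n : ℕ) (y : ℝ → ℝ → ℝ) : ℝ :=
  Real.sqrt (∑ j ∈ Finset.range (n + 1), ∑ k ∈ Finset.range (n + 1 - j),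
    ∫ t in (0:ℝ)..T, (normN N k (dt^[j] y t)) ^ 2)

/-- `Z_n(H)(t) = ∑_{j+k=n} ‖∂_t^j H(t,·)‖_k`. -/
def ZZ (N : ℝ) (n : ℕ) (H : ℝ → ℝ → ℝ) (t : ℝ) : ℝ :=
  ∑ j ∈ Finset.range (n + 1), normN N (n - j) (dt^[j] H t)

/-- The operator `𝒜h = -b₂ Δh + b₁ Ďh + b₀ h` with time-dependent coefficients. -/
def opA (N : ℝ) (b₂ b₁ b₀ : ℝ → ℝ → ℝ) (H : ℝ → ℝ → ℝ) : ℝ → ℝ → ℝ :=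
  fun t z => -(b₂ t z) * Del N (H t) z + b₁ t z * (z * deriv (H t) z) + b₀ t z * H t z

end


lemma hs_congr {g h : ℕ → ℝ} {x : ℝ} (e : ∀ k, g k = h k) (hg : HasSum g x) : HasSum h x := by
  rwa [funext e] at hg

lemma aux_summable (b d : ℕ → ℝ) (hb : ∀ k, 0 ≤ b k) (hd0 : ∀ k, 0 ≤ d k) (hd : Summable d)
    (h : ∀ k, b (k+1) ≤ b k / 2 + d k) : Summable b := by
  have key : ∀ n, ∑ k ∈ Finset.range n, b k + 2 * b n ≤ 2 * b 0 + 2 * ∑ k ∈ Finset.range n, d k := by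
    intro n
    induction n with
    | zero => simp
    | succ n ih =>
      rw [Finset.sum_range_succ, Finset.sum_range_succ]
      linarith [h n]
  refine summable_of_sum_range_le (c := 2 * b 0 + 2 * ∑' k, d k) hb ?_
  intro n
  have := hd.sum_le_tsum (Finset.range n) (fun i _ => hd0 i)
  linarith [key n, hb n]

lemma aux_deriv_summable (a : ℕ → ℝ) (ha : ∀ z : ℝ, Summable (fun k => a k * z ^ k)) (R : ℝ)
    (hR : 1 ≤ R) : Summable (fun k : ℕ => |a k| * (k * R ^ (k-1))) := by
  have h := (ha (2 * R)).abs
  refine Summable.of_nonneg_of_le (fun k => by positivity) (fun k => ?_) h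
  rw [abs_mul, abs_of_pos (show 0 < (2 * R) ^ k by positivity), mul_pow]
  have h1 : (k:ℝ) ≤ 2 ^ k := by exact_mod_cast (Nat.lt_two_pow_self).le
  have h2 : R ^ (k-1) ≤ R ^ k := pow_le_pow_right₀ hR (Nat.sub_le _ _)
  gcongr

lemma aux_deriv (a : ℕ → ℝ) (ha : ∀ z : ℝ, Summable (fun k => a k * z ^ k)) :
    (∀ z : ℝ, Summable (fun k : ℕ => ((k:ℝ)+1) * a (k+1) * z ^ k)) ∧
    ∀ z, HasDerivAt (fun z => ∑' k, a k * z ^ k) (∑' k : ℕ, ((k:ℝ)+1) * a (k+1) * z ^ k) z := by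
  have hs : ∀ z : ℝ, Summable (fun k : ℕ => a k * (k * z ^ (k-1))) := by
    intro z
    have := aux_deriv_summable a ha (|z| + 1) (by linarith [abs_nonneg z])
    refine Summable.of_norm_bounded this (fun k => ?_)
    rw [norm_eq_abs, abs_mul, abs_mul, abs_pow, Nat.abs_cast]
    gcongr
    linarith
  have e : ∀ z : ℝ, (fun k : ℕ => ((k:ℝ)+1) * a (k+1) * z ^ k) =
      fun k => (fun k : ℕ => a k * (k * z ^ (k-1))) (k+1) := by
    intro z; ext k; simp; ring
  constructor
  · intro z
    rw [e]
    exact (summable_nat_add_iff 1).2 (hs z)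
  · intro z
    rw [e]
    have e2 := (hs z).tsum_eq_zero_add
    simp only [Nat.cast_zero, zero_mul, mul_zero, zero_add] at e2
    rw [← e2]
    refine hasDerivAt_tsum_of_isPreconnected
      (aux_deriv_summable a ha (|z| + 1) (by linarith [abs_nonneg z]))
      (Metric.isOpen_ball (x := (0:ℝ)) (ε := |z|+1)) (convex_ball _ _).isPreconnected
      (g := fun k z => a k * z ^ k) (g' := fun k z => a k * (k * z ^ (k-1))) (y₀ := z) ?_ ?_ ?_ (ha z) ?_
    · intro n w _
      exact (hasDerivAt_pow n w).const_mul _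
    · intro n w hw
      rw [norm_eq_abs, abs_mul, abs_mul, abs_pow, Nat.abs_cast]
      have : |w| < |z| + 1 := by simpa using hw
      gcongr
    · simp
    · simp

noncomputable def recA (nu lam a0 : ℝ) (c : ℕ → ℝ) : ℕ → ℝ
  | 0 => a0
  | k+1 => -(lam * recA nu lam a0 c k + c k) / (((k:ℝ)+1) * (k + nu))

lemma recA_summable (nu lam a0 : ℝ) (hnu : 2 ≤ nu) (hlam : 0 < lam) (c : ℕ → ℝ)
    (hc : ∀ z : ℝ, Summable (fun k => c k * z ^ k)) (z : ℝ) :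
    Summable (fun k => recA nu lam a0 c k * z ^ k) := by
  apply Summable.of_abs
  obtain ⟨K, hK⟩ := exists_nat_ge (2 * lam * |z|)
  rw [← summable_nat_add_iff K]
  refine aux_summable _ (fun k => |z| * |c (k+K) * z ^ (k+K)|) (fun _ => abs_nonneg _)
    (fun _ => by positivity) (((summable_nat_add_iff K).2 (hc z).abs).mul_left _) ?_
  intro k
  have e : k + 1 + K = (k + K) + 1 := by ring
  rw [e]
  generalize hm : k + K = m
  have hmK : (K:ℝ) ≤ m := by exact_mod_cast (by omega : K ≤ m)
  have hm0 : (0:ℝ) ≤ m := by positivity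
  set D := ((m:ℝ)+1) * (m + nu) with hD
  have hD1 : 1 ≤ D := by nlinarith
  have hD2 : 2 * lam * |z| ≤ D := by nlinarith
  have hDp : 0 < D := by linarith
  have : recA nu lam a0 c (m+1) * z ^ (m+1) =
    (-(lam * z * (recA nu lam a0 c m * z ^ m)) - z * (c m * z^m)) / D := by
    rw [recA, ← hD]; ring
  rw [this, abs_div, abs_of_pos hDp, div_le_iff₀ hDp]
  refine (abs_sub _ _).trans ?_
  rw [abs_neg, abs_mul, abs_mul, abs_mul z, abs_of_pos hlam]
  have A := abs_nonneg (recA nu lam a0 c m * z ^ m)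
  have B : 0 ≤ |z| * |c m * z ^ m| := by positivity
  nlinarith [mul_le_mul_of_nonneg_right hD2 A, mul_le_mul_of_nonneg_left hD1 B]

lemma series_sol (nu lam a0 : ℝ) (hnu : 2 ≤ nu) (hlam : 0 < lam) (c : ℕ → ℝ) (f : ℝ → ℝ)
    (hf : ∀ z : ℝ, HasSum (fun k => c k * z ^ k) (f z)) :
    ∃ (a : ℕ → ℝ) (p p1 p2 : ℝ → ℝ), (∀ z : ℝ, HasSum (fun k => a k * z ^ k) (p z)) ∧
      p 0 = a0 ∧ (∀ z, HasDerivAt p (p1 z) z) ∧ (∀ z, HasDerivAt p1 (p2 z) z) ∧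
      ∀ z, z * p2 z + nu * p1 z + lam * p z = - f z := by
  set a := recA nu lam a0 c with hadef
  have ha := recA_summable nu lam a0 hnu hlam c (fun z => (hf z).summable)
  obtain ⟨s1, d1⟩ := aux_deriv a ha
  obtain ⟨s2, d2⟩ := aux_deriv (fun k : ℕ => ((k:ℝ)+1) * a (k+1)) s1
  refine ⟨a, _, _, _, fun z => (ha z).hasSum, ?_, d1, d2, ?_⟩
  · rw [tsum_eq_single 0]
    · simp [hadef, recA]
    · intro k hk; simp [hk]
  · intro z
    have h2 := (s2 z).hasSum.mul_left z
    have h2' : HasSum (fun k : ℕ => (k:ℝ) * (((k:ℝ)+1) * a (k+1)) * z ^ k)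
        (z * ∑' k : ℕ, ((k:ℝ)+1) * ((((k+1:ℕ):ℝ)+1) * a (k+1+1)) * z ^ k) := by
      rw [← hasSum_nat_add_iff' 1]
      simp only [Finset.sum_range_one, Nat.cast_zero, zero_mul, sub_zero]
      refine hs_congr (fun k => ?_) h2
      push_cast; ring
    have h := (h2'.add ((s1 z).hasSum.mul_left nu)).add ((ha z).hasSum.mul_left lam)
    refine h.unique ?_
    refine hs_congr (fun k => ?_) (hf z).neg
    have : a (k+1) = -(lam * a k + c k) / (((k:ℝ)+1) * (k + nu)) := by simp [hadef, recA]
    have h0 : (k:ℝ) + nu ≠ 0 := by positivity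
    have h1 : (k:ℝ) + 1 ≠ 0 := by positivity
    have : a (k+1) * (((k:ℝ)+1) * (k + nu)) = -(lam * a k + c k) := by rw [this]; field_simp
    linear_combination (-z ^ k) * this

lemma lemA (nu m δ : ℝ) (hnu : 2 ≤ nu) (hm : 0 < m) (hδ : 0 < δ) (g g' : ℝ → ℝ)
    (hg : ∀ z ∈ Ioo 0 δ, HasDerivAt g (g' z) z) (hg' : ∀ z ∈ Ioo 0 δ, m * z ^ (-nu) ≤ g' z) :
    ∃ K, ∀ z ∈ Ioo 0 (δ/2), g z ≤ K - m / (nu - 1) * z ^ (1 - nu) := by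
  have hd : ∀ z ∈ Ioo 0 δ, HasDerivAt (fun z => g z + m / (nu - 1) * z ^ (1 - nu))
      (g' z - m * z ^ (-nu)) z := by
    intro z hz
    have := (hg z hz).add ((Real.hasDerivAt_rpow_const (x := z) (p := 1 - nu)
      (Or.inl hz.1.ne')).const_mul (m / (nu-1)))
    refine HasDerivAt.congr_deriv this ?_
    have : nu - 1 ≠ 0 := by linarith
    rw [show 1 - nu - 1 = -nu by ring]
    field_simp
    ring
  have mono : MonotoneOn (fun z => g z + m / (nu - 1) * z ^ (1 - nu)) (Ioo 0 δ) := by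
    apply monotoneOn_of_deriv_nonneg (convex_Ioo _ _)
    · exact fun z hz => (hd z hz).continuousAt.continuousWithinAt
    · rw [interior_Ioo]
      exact fun z hz => (hd z hz).differentiableAt.differentiableWithinAt
    · rw [interior_Ioo]
      intro z hz
      rw [(hd z hz).deriv]
      linarith [hg' z hz]
  refine ⟨g (δ/2) + m / (nu - 1) * (δ/2) ^ (1 - nu), fun z hz => ?_⟩
  have := mono (a := z) (b := δ/2) ⟨hz.1, by linarith [hz.2]⟩ ⟨by linarith, by linarith⟩ hz.2.le
  exact le_sub_iff_add_le.2 this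

lemma lemB (nu k K δ : ℝ) (hnu : 2 ≤ nu) (hk : 0 < k) (hδ : 0 < δ) (y : ℝ → ℝ)
    (hy : ∀ z ∈ Ioo 0 δ, y z ≤ K - k * z ^ (1 - nu))
    (hX : IntegrableOn (fun z => (y z) ^ 2 * z ^ (nu - 1)) (Ioc (0:ℝ) 1)) : False := by
  set t := min (min δ 1) (k / (2 * (|K| + 1))) with ht
  have ht0 : 0 < t := by positivity
  have ht1 : t ≤ 1 := (min_le_left _ _).trans (min_le_right _ _)
  have htd : t ≤ δ := (min_le_left _ _).trans (min_le_left _ _)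
  have htk : t ≤ k / (2 * (|K| + 1)) := min_le_right _ _
  have hX' : IntegrableOn (fun z => (y z) ^ 2 * z ^ (nu - 1)) (Ioo (0:ℝ) t) :=
    hX.mono_set (fun z hz => ⟨hz.1, hz.2.le.trans ht1⟩)
  have hI : IntegrableOn (fun z : ℝ => k^2/4 * z ^ (-1:ℝ)) (Ioo (0:ℝ) t) := by
    refine Integrable.mono' hX' (by fun_prop) ?_
    refine (ae_restrict_iff' measurableSet_Ioo).2 (Filter.Eventually.of_forall fun z hz => ?_)
    have z0 : 0 < z := hz.1
    rw [norm_of_nonneg (by positivity)]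
    have h1 : z ^ (-1:ℝ) ≤ z ^ (1 - nu) :=
      Real.rpow_le_rpow_of_exponent_ge z0 (hz.2.le.trans ht1) (by linarith)
    have h2 : K ≤ k / 2 * z ^ (-1:ℝ) := by
      rw [Real.rpow_neg_one]
      have : z * (2 * (|K| + 1)) ≤ k := (le_div_iff₀ (by positivity)).1 (hz.2.le.trans htk)
      rw [← div_eq_mul_inv, le_div_iff₀ z0]
      nlinarith [le_abs_self K]
    have h3 := hy z ⟨z0, hz.2.trans_le htd⟩
    set A := z ^ (1 - nu) with hA
    have hA0 : 0 < A := by positivity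
    have h4 : k / 2 * A ≤ - y z := by nlinarith
    have h5 : k^2/4 * A^2 ≤ y z ^ 2 := by
      have : 0 ≤ k / 2 * A := by positivity
      nlinarith
    have h6 : A * z ^ (nu - 1) = 1 := by
      rw [hA, ← Real.rpow_add z0]; simp
    have h7 : 0 < z ^ (nu - 1) := by positivity
    calc k^2/4 * z ^ (-1:ℝ) ≤ k^2/4 * A := by gcongr
      _ = k^2/4 * A^2 * z ^ (nu-1) := by linear_combination (-k^2/4 * A) * h6
      _ ≤ _ := by gcongr
  have h := hI.const_mul (4/k^2)
  have e : (fun z : ℝ => 4/k^2 * (k^2/4 * z ^ (-1:ℝ))) = fun z : ℝ => z ^ (-1:ℝ) := by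
    ext z; field_simp
  rw [e] at h
  have := (intervalIntegral.integrableOn_Ioo_rpow_iff ht0).1 h
  norm_num at this

/-- Wronskian constant cannot be positive. -/
lemma lemC (nu C δ M : ℝ) (hnu : 2 ≤ nu) (hC : 0 < C) (hδ : 0 < δ)
    (u p1 u1 p y : ℝ → ℝ) (hp : ∀ z ∈ Ioo 0 δ, HasDerivAt p (p1 z) z)
    (hu : ∀ z ∈ Ioo 0 δ, HasDerivAt u (u1 z) z)
    (hW : ∀ z ∈ Ioo 0 δ, z ^ nu * (p z * u1 z - p1 z * u z) = C)
    (hpl : ∀ z ∈ Ioo 0 δ, 1/2 ≤ p z) (hpu : ∀ z ∈ Ioo 0 δ, p z ≤ 2)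
    (hyu : ∀ z ∈ Ioo 0 δ, y z ≤ u z + M)
    (hX : IntegrableOn (fun z => (y z) ^ 2 * z ^ (nu - 1)) (Ioc (0:ℝ) 1)) : False := by
  obtain ⟨K, hK⟩ := lemA nu (C/4) δ hnu (by positivity) hδ (fun z => u z / p z)
    (fun z => (u1 z * p z - u z * p1 z) / p z ^ 2)
    (fun z hz => (hu z hz).div (hp z hz) (by linarith [hpl z hz])) (by
      intro z hz
      have h1 := hpl z hz
      have h2 := hpu z hz
      have z0 : 0 < z := hz.1
      have : u1 z * p z - u z * p1 z = C * z ^ (-nu) := by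
        have e : z ^ (-nu) * z ^ nu = 1 := by rw [← Real.rpow_add z0]; simp
        rw [← hW z hz]
        linear_combination (-(u1 z * p z - u z * p1 z)) * e
      rw [this, le_div_iff₀ (by positivity)]
      have : 0 < C * z ^ (-nu) := by positivity
      have : p z ^ 2 ≤ 4 := by nlinarith
      nlinarith)
  have hk : 0 < C / 4 / (nu - 1) := div_pos (by positivity) (by linarith)
  refine lemB nu (C/4/(nu-1)/2) (2 * |K| + M) (δ/2) hnu (by positivity) (by positivity) y ?_ hX
  intro z hz
  have hz' : z ∈ Ioo 0 δ := ⟨hz.1, by linarith [hz.2]⟩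
  have z0 : 0 < z := hz.1
  have h := hK z hz
  have h1 := hpl z hz'
  have h2 := hpu z hz'
  have h3 := hyu z hz'
  rw [div_le_iff₀ (by linarith)] at h
  have : 0 < C / 4 / (nu - 1) * z ^ (1 - nu) := by positivity
  nlinarith [le_abs_self K, abs_nonneg K]

lemma core (nu lam : ℝ) (hnu : 2 ≤ nu) (hlam : 0 < lam) (y y1 y2 f : ℝ → ℝ)
    (p p1 p2 s s1 s2 : ℝ → ℝ)
    (hy : ∀ z ∈ Ioo (0:ℝ) 1, HasDerivAt y (y1 z) z)
    (hy1 : ∀ z ∈ Ioo (0:ℝ) 1, HasDerivAt y1 (y2 z) z)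
    (hp0 : p 0 = 1)
    (hp : ∀ z, HasDerivAt p (p1 z) z) (hp1 : ∀ z, HasDerivAt p1 (p2 z) z)
    (hs : ∀ z, HasDerivAt s (s1 z) z) (hs1 : ∀ z, HasDerivAt s1 (s2 z) z)
    (ey : ∀ z ∈ Ioo (0:ℝ) 1, z * y2 z + nu * y1 z + lam * y z = - f z)
    (es : ∀ z, z * s2 z + nu * s1 z + lam * s z = - f z)
    (ep : ∀ z, z * p2 z + nu * p1 z + lam * p z = 0)
    (hX : IntegrableOn (fun z => (y z) ^ 2 * z ^ (nu - 1)) (Ioc (0:ℝ) 1)) :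
    ∃ A, ∀ z ∈ Ioo (0:ℝ) 1, y z = s z + A * p z := by
  have hu : ∀ z ∈ Ioo (0:ℝ) 1, HasDerivAt (fun z => y z - s z) (y1 z - s1 z) z :=
    fun z hz => (hy z hz).sub (hs z)
  have hu1 : ∀ z ∈ Ioo (0:ℝ) 1, HasDerivAt (fun z => y1 z - s1 z) (y2 z - s2 z) z :=
    fun z hz => (hy1 z hz).sub (hs1 z)
  -- Wronskian
  have hWd : ∀ z ∈ Ioo (0:ℝ) 1, HasDerivAt
      (fun z => z ^ nu * (p z * (y1 z - s1 z) - p1 z * (y z - s z))) 0 z := by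
    intro z hz
    have h := (Real.hasDerivAt_rpow_const (x := z) (p := nu) (Or.inl hz.1.ne')).mul
      (((hp z).mul (hu1 z hz)).sub ((hp1 z).mul (hu z hz)))
    refine HasDerivAt.congr_deriv h ?_
    have e : z ^ nu = z ^ (nu - 1) * z := by
      rw [← Real.rpow_add_one hz.1.ne']; simp
    try simp only [Pi.mul_apply, Pi.sub_apply]
    rw [e]
    linear_combination (-z ^ (nu-1)) * ((-p z) * (ey z hz - es z) + (y z - s z) * ep z) 
  obtain ⟨C, hC⟩ : ∃ C, ∀ z ∈ Ioo (0:ℝ) 1,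
      z ^ nu * (p z * (y1 z - s1 z) - p1 z * (y z - s z)) = C := by
    refine isOpen_Ioo.exists_is_const_of_deriv_eq_zero isPreconnected_Ioo
      (fun z hz => (hWd z hz).differentiableAt.differentiableWithinAt) (fun z hz => (hWd z hz).deriv)
  -- neighbourhood of zero
  obtain ⟨δ, hδ0, hδ1, hδ⟩ : ∃ δ > 0, δ ≤ 1 ∧ ∀ z ∈ Ioo 0 δ,
      (1/2 ≤ p z ∧ p z ≤ 2) ∧ |s z| ≤ |s 0| + 1 := by
    have h1 : ∀ᶠ z in nhds (0:ℝ), p z ∈ Ioo (1/2:ℝ) 2 :=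
      (hp 0).continuousAt.eventually (by rw [hp0]; exact Ioo_mem_nhds (by norm_num) (by norm_num))
    have h2 : ∀ᶠ z in nhds (0:ℝ), |s z| < |s 0| + 1 :=
      (hs 0).continuousAt.abs.eventually_lt_const (by linarith)
    obtain ⟨e, he, h⟩ := Metric.eventually_nhds_iff.1 (h1.and h2)
    refine ⟨min e 1, by positivity, min_le_right _ _, fun z hz => ?_⟩
    have := @h z (by rw [Real.dist_eq, sub_zero, abs_of_pos hz.1]; exact hz.2.trans_le (min_le_left _ _))
    exact ⟨⟨this.1.1.le, this.1.2.le⟩, this.2.le⟩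
  have hsub : ∀ z ∈ Ioo 0 δ, z ∈ Ioo (0:ℝ) 1 := fun z hz => ⟨hz.1, hz.2.trans_le hδ1⟩
  have C0 : C = 0 := by
    rcases lt_trichotomy C 0 with h | h | h
    · exfalso
      refine lemC nu (-C) δ (|s 0| + 1) hnu (by linarith) hδ0 (fun z => -(y z - s z)) p1
        (fun z => -(y1 z - s1 z)) p (fun z => - y z) (fun z _ => hp z)
        (fun z hz => (hu z (hsub z hz)).neg) ?_ (fun z hz => (hδ z hz).1.1)
        (fun z hz => (hδ z hz).1.2) ?_ (by simpa using hX)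
      · intro z hz
        linear_combination - hC z (hsub z hz)
      · intro z hz
        have := abs_le.1 (hδ z hz).2
        linarith [this.1, this.2]
    · exact h
    · exfalso
      refine lemC nu C δ (|s 0| + 1) hnu h hδ0 (fun z => (y z - s z)) p1
        (fun z => (y1 z - s1 z)) p y (fun z _ => hp z)
        (fun z hz => (hu z (hsub z hz))) (fun z hz => hC z (hsub z hz)) (fun z hz => (hδ z hz).1.1)
        (fun z hz => (hδ z hz).1.2) ?_ hX
      intro z hz
      have := abs_le.1 (hδ z hz).2
      linarith [this.1, this.2]
  subst C0
  have hW0 : ∀ z ∈ Ioo (0:ℝ) 1, p z * (y1 z - s1 z) - p1 z * (y z - s z) = 0 := by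
    intro z hz
    have : 0 < z ^ nu := Real.rpow_pos_of_pos hz.1 _
    exact (mul_eq_zero.1 (hC z hz)).resolve_left this.ne'
  have hqd : ∀ z ∈ Ioo 0 δ, HasDerivAt (fun z => (y z - s z) / p z) 0 z := by
    intro z hz
    have h := (hu z (hsub z hz)).div (hp z) (by linarith [(hδ z hz).1.1])
    refine HasDerivAt.congr_deriv h ?_
    rw [show (y1 z - s1 z) * p z - (y z - s z) * p1 z = 0 by linarith [hW0 z (hsub z hz)]]
    simp
  obtain ⟨A, hA⟩ : ∃ A, ∀ z ∈ Ioo 0 δ, (y z - s z) / p z = A :=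
    isOpen_Ioo.exists_is_const_of_deriv_eq_zero isPreconnected_Ioo
      (fun z hz => (hqd z hz).differentiableAt.differentiableWithinAt) (fun z hz => (hqd z hz).deriv)
  have hnear : ∀ z ∈ Ioo 0 δ, y z = s z + A * p z := by
    intro z hz
    have := hA z hz
    rw [div_eq_iff (by linarith [(hδ z hz).1.1])] at this
    linarith
  refine ⟨A, fun z hz => ?_⟩
  by_cases hzδ : z < δ
  · exact hnear z ⟨hz.1, hzδ⟩
  push Not at hzδ
  -- energy
  have hw : ∀ z ∈ Ioo (0:ℝ) 1, HasDerivAt (fun z => y z - s z - A * p z) (y1 z - s1 z - A * p1 z) z :=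
    fun z hz => (hu z hz).sub ((hp z).const_mul A)
  have hw1 : ∀ z ∈ Ioo (0:ℝ) 1,
      HasDerivAt (fun z => y1 z - s1 z - A * p1 z) (y2 z - s2 z - A * p2 z) z :=
    fun z hz => (hu1 z hz).sub ((hp1 z).const_mul A)
  have hE : ∀ z ∈ Ioo (0:ℝ) 1, HasDerivAt
      (fun z => z * (y1 z - s1 z - A * p1 z) ^ 2 + lam * (y z - s z - A * p z) ^ 2)
      ((1 - 2 * nu) * (y1 z - s1 z - A * p1 z) ^ 2) z := by
    intro z hz
    have h := ((hasDerivAt_id z).mul ((hw1 z hz).pow 2)).add (((hw z hz).pow 2).const_mul lam)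
    refine HasDerivAt.congr_deriv h ?_
    try simp only [Pi.pow_apply, id]
    push_cast
    linear_combination (2 * (y1 z - s1 z - A * p1 z)) * (ey z hz - es z - A * ep z)
  have anti : AntitoneOn
      (fun z => z * (y1 z - s1 z - A * p1 z) ^ 2 + lam * (y z - s z - A * p z) ^ 2) (Ioo (0:ℝ) 1) := by
    apply antitoneOn_of_deriv_nonpos (convex_Ioo _ _)
    · exact fun z hz => (hE z hz).continuousAt.continuousWithinAt
    · rw [interior_Ioo]
      exact fun z hz => (hE z hz).differentiableAt.differentiableWithinAt
    · rw [interior_Ioo]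
      intro z hz
      rw [(hE z hz).deriv]
      nlinarith [sq_nonneg (y1 z - s1 z - A * p1 z)]
  have hm : δ/2 ∈ Ioo 0 δ := ⟨by linarith, by linarith⟩
  have hle := anti (hsub _ hm) hz (by linarith)
  have v0 : y (δ/2) - s (δ/2) - A * p (δ/2) = 0 := by linarith [hnear _ hm]
  have v1 : y1 (δ/2) - s1 (δ/2) - A * p1 (δ/2) = 0 := by
    have h1 := hW0 _ (hsub _ hm)
    have h2 : p (δ/2) ≠ 0 := by linarith [(hδ _ hm).1.1]
    have : p (δ/2) * (y1 (δ/2) - s1 (δ/2) - A * p1 (δ/2)) = 0 := by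
      linear_combination h1 + p1 (δ/2) * v0
    exact (mul_eq_zero.1 this).resolve_left h2
  simp only [v0, v1] at hle
  have h1 : 0 ≤ z * (y1 z - s1 z - A * p1 z) ^ 2 := mul_nonneg hz.1.le (sq_nonneg _)
  have h2 : (y z - s z - A * p z) ^ 2 ≤ 0 := by
    by_contra hh
    push Not at hh
    nlinarith [mul_pos hlam hh]
  have h3 := pow_eq_zero_iff (two_ne_zero) |>.1 (le_antisymm h2 (sq_nonneg _))
  linarith

theorem stmt3 (N : ℝ) (hN : 4 ≤ N) (lam : ℝ) (hlam : 0 < lam)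
    (c : ℕ → ℝ) (f : ℝ → ℝ)
    (hf : ∀ z : ℝ, HasSum (fun k => c k * z ^ k) (f z))
    (y : ℝ → ℝ)
    (hreg : ContDiffOn ℝ 2 y (Ioc (0:ℝ) 1))
    (heq : ∀ z ∈ Ioo (0:ℝ) 1,
      -lam * y z - (z * deriv (deriv y) z + (N / 2) * deriv y z) = f z)
    (hX : IntegrableOn (fun z => (y z) ^ 2 * z ^ (N / 2 - 1)) (Ioc (0:ℝ) 1)) :
    ∃ a : ℕ → ℝ,
      (∀ z : ℝ, Summable (fun k => a k * z ^ k)) ∧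
      (∀ z ∈ Ioc (0:ℝ) 1, y z = ∑' k, a k * z ^ k) := by
  have hnu : 2 ≤ N / 2 := by linarith
  obtain ⟨a, s, s1, s2, ha, -, hs, hs1, es⟩ := series_sol (N/2) lam 0 hnu hlam c f hf
  obtain ⟨b, p, p1, p2, hb, hp0, hp, hp1, ep⟩ := series_sol (N/2) lam 1 hnu hlam (fun _ => 0)
    (fun _ => 0) (fun z => by simp)
  have hreg' : ContDiffOn ℝ (1 + 1) y (Ioo (0:ℝ) 1) := by
    rw [one_add_one_eq_two]; exact hreg.mono Ioo_subset_Ioc_self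
  rw [contDiffOn_succ_iff_deriv_of_isOpen isOpen_Ioo] at hreg'
  obtain ⟨A, hA⟩ := core (N/2) lam hnu hlam y (deriv y) (deriv (deriv y)) f p p1 p2 s s1 s2
    (fun z hz => ((hreg'.1 z hz).differentiableAt (isOpen_Ioo.mem_nhds hz)).hasDerivAt)
    (fun z hz => (((hreg'.2.2.differentiableOn one_ne_zero) z hz).differentiableAt
      (isOpen_Ioo.mem_nhds hz)).hasDerivAt) hp0 hp hp1 hs hs1
    (fun z hz => by linarith [heq z hz]) es (fun z => by simpa using ep z) hX
  have hsum : ∀ z : ℝ, HasSum (fun k => (a k + A * b k) * z ^ k) (s z + A * p z) := by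
    intro z
    convert (ha z).add ((hb z).mul_left A) using 1
    ext k; ring
  refine ⟨fun k => a k + A * b k, fun z => (hsum z).summable, fun z hz => ?_⟩
  rw [(hsum z).tsum_eq]
  rcases hz.2.lt_or_eq with h | rfl
  · exact hA z ⟨hz.1, h⟩
  · have h1 : Filter.Tendsto y (nhdsWithin 1 (Ioo 0 1)) (nhds (y 1)) :=
      (hreg.continuousOn 1 hz).mono_left (nhdsWithin_mono _ Ioo_subset_Ioc_self)
    have h2 : Filter.Tendsto (fun z => s z + A * p z) (nhdsWithin 1 (Ioo 0 1))
        (nhds (s 1 + A * p 1)) :=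
      (((hs 1).add ((hp 1).const_mul A)).continuousAt).tendsto.mono_left nhdsWithin_le_nhds
    have : (nhdsWithin (1:ℝ) (Ioo 0 1)).NeBot := by
      rw [← mem_closure_iff_nhdsWithin_neBot, closure_Ioo (by norm_num)]
      exact ⟨by norm_num, le_rfl⟩
    refine tendsto_nhds_unique (h1.congr' ?_) h2
    filter_upwards [self_mem_nhdsWithin] with z hz using hA z hz
end

section
/- Let N ≥ 4 be a real number, let F(z,y) be a smooth real function on [0,1]×ℝ, let C₀ > 0, and let m ≥ 1 be an integer. Then there is a constant C > 0 such that for every y ∈ C^∞([0,1]) with ‖y‖_{L^∞(0,1)} ≤ C₀: ‖Δ^m (z ↦ F(z, y(z)))‖_{L^∞(0,1)} ≤ C·(1 + |y|_m), where |y|_m = sup_{0≤j≤m} ‖Δ^j y‖_{L^∞(0,1)}. -/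
open MeasureTheory Real Set

lemma sm_deriv {f : ℝ → ℝ} (hf : ContDiff ℝ (⊤ : ℕ∞) f) : ContDiff ℝ (⊤ : ℕ∞) (deriv f) :=
  (contDiff_infty_iff_deriv.mp hf).2

lemma sm_diff {f : ℝ → ℝ} (hf : ContDiff ℝ (⊤ : ℕ∞) f) : Differentiable ℝ f :=
  (contDiff_infty_iff_deriv.mp hf).1

lemma sm_iter {f : ℝ → ℝ} (hf : ContDiff ℝ (⊤ : ℕ∞) f) (n : ℕ) :
    ContDiff ℝ (⊤ : ℕ∞) (iteratedDeriv n f) := by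
  rw [iteratedDeriv_eq_iterate]
  exact ContDiff.iterate_deriv n hf

lemma sm_Del (N : ℝ) {f : ℝ → ℝ} (hf : ContDiff ℝ (⊤ : ℕ∞) f) :
    ContDiff ℝ (⊤ : ℕ∞) (Del N f) := by
  have h1 := sm_deriv hf
  have h2 := sm_deriv h1
  unfold Del
  exact (contDiff_id.mul h2).add (contDiff_const.mul h1)

lemma sm_DelIter (N : ℝ) (m : ℕ) {f : ℝ → ℝ} (hf : ContDiff ℝ (⊤ : ℕ∞) f) :
    ContDiff ℝ (⊤ : ℕ∞) (DelIter N m f) := by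
  induction m with
  | zero => exact hf
  | succ m ih => exact sm_Del N ih

lemma DelIter_succ' (N : ℝ) (m : ℕ) (f : ℝ → ℝ) :
    DelIter N (m + 1) f = DelIter N m (Del N f) := by
  induction m with
  | zero => rfl
  | succ m ih =>
    change Del N (DelIter N (m + 1) f) = Del N (DelIter N m (Del N f))
    rw [ih]

/-- `D^n Δ f = z D^{n+2} f + (n + N/2) D^{n+1} f`. -/
lemma iter_Del (N : ℝ) {f : ℝ → ℝ} (hf : ContDiff ℝ (⊤ : ℕ∞) f) (n : ℕ) :
    iteratedDeriv n (Del N f) = fun z => z * iteratedDeriv (n + 2) f z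
      + (n + N / 2) * iteratedDeriv (n + 1) f z := by
  induction n with
  | zero =>
    funext z
    simp only [iteratedDeriv_zero, Del, iteratedDeriv_succ]
    simp
  | succ n ih =>
    funext z
    rw [iteratedDeriv_succ, ih]
    have h1 : HasDerivAt (iteratedDeriv (n + 2) f) (iteratedDeriv (n + 3) f z) z := by
      rw [iteratedDeriv_succ (n := n + 2)]
      exact (sm_diff (sm_iter hf (n + 2)) z).hasDerivAt
    have h2 : HasDerivAt (iteratedDeriv (n + 1) f) (iteratedDeriv (n + 2) f z) z := by
      rw [iteratedDeriv_succ (n := n + 1)]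
      exact (sm_diff (sm_iter hf (n + 1)) z).hasDerivAt
    have h3 := ((hasDerivAt_id z).mul h1).add (h2.const_mul ((n : ℝ) + N / 2))
    have h4 : deriv (fun z => z * iteratedDeriv (n + 2) f z
      + (n + N / 2) * iteratedDeriv (n + 1) f z) z = _ := h3.deriv
    rw [h4]
    push_cast
    simp only [id]
    ring

lemma deriv_Del (N : ℝ) {f : ℝ → ℝ} (hf : ContDiff ℝ (⊤ : ℕ∞) f) :
    deriv (Del N f) = Del (N + 2) (deriv f) := by
  have h := iter_Del N hf 1
  rw [iteratedDeriv_one] at h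
  rw [h]
  funext z
  simp only [Del, iteratedDeriv_succ, iteratedDeriv_zero]
  push_cast
  ring

lemma deriv_DelIter (N : ℝ) (m : ℕ) {f : ℝ → ℝ} (hf : ContDiff ℝ (⊤ : ℕ∞) f) :
    deriv (DelIter N m f) = DelIter (N + 2) m (deriv f) := by
  induction m with
  | zero => rfl
  | succ m ih =>
    change deriv (Del N (DelIter N m f)) = Del (N + 2) (DelIter (N + 2) m (deriv f))
    rw [deriv_Del N (sm_DelIter N m hf), ih]

lemma deriv_le_aux (N : ℝ) (hN : 4 ≤ N) {f : ℝ → ℝ} (hf : ContDiff ℝ (⊤ : ℕ∞) f) (S : ℝ)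
    (hS : ∀ z ∈ Icc (0:ℝ) 1, Del N f z ≤ S) (z : ℝ) (hz : z ∈ Icc (0:ℝ) 1) :
    deriv f z ≤ S / (N / 2) := by
  rcases eq_or_lt_of_le hz.1 with h0 | h0
  · subst h0
    have := hS 0 hz
    simp only [Del, zero_mul, zero_add] at this
    rw [le_div_iff₀ (by linarith)]
    linarith
  have hd : ∀ x : ℝ, HasDerivAt (fun x : ℝ => S / (N / 2) * x ^ (N / 2) - x ^ (N / 2) * deriv f x)
      (S / (N / 2) * ((N / 2) * x ^ (N / 2 - 1)) - ((N / 2) * x ^ (N / 2 - 1) * deriv f x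
        + x ^ (N / 2) * deriv (deriv f) x)) x := by
    intro x
    have h1 : HasDerivAt (fun x : ℝ => x ^ (N / 2)) ((N / 2) * x ^ (N / 2 - 1)) x :=
      Real.hasDerivAt_rpow_const (Or.inr (by linarith))
    have h2 : HasDerivAt (deriv f) (deriv (deriv f) x) x :=
      (sm_diff (sm_deriv hf) x).hasDerivAt
    exact (h1.const_mul _).sub (h1.mul h2)
  have hmono : MonotoneOn (fun x : ℝ => S / (N / 2) * x ^ (N / 2) - x ^ (N / 2) * deriv f x)
      (Icc (0:ℝ) 1) := by
    apply monotoneOn_of_deriv_nonneg (convex_Icc 0 1)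
    · exact fun x _ => (hd x).continuousAt.continuousWithinAt
    · exact fun x _ => (hd x).differentiableAt.differentiableWithinAt
    · intro x hx
      rw [interior_Icc] at hx
      rw [(hd x).deriv]
      have e : x ^ (N / 2) = x ^ (N / 2 - 1) * x := by
        rw [← Real.rpow_add_one hx.1.ne']; congr 1; ring
      rw [e]
      have h3 := hS x ⟨hx.1.le, hx.2.le⟩
      have h4 : 0 ≤ x ^ (N / 2 - 1) := Real.rpow_nonneg hx.1.le _
      have : S / (N / 2) * ((N / 2) * x ^ (N / 2 - 1)) - ((N / 2) * x ^ (N / 2 - 1) * deriv f x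
        + x ^ (N / 2 - 1) * x * deriv (deriv f) x) = x ^ (N / 2 - 1) * (S - Del N f x) := by
        unfold Del
        field_simp
        ring
      rw [this]
      exact mul_nonneg h4 (by linarith)
  have h5 := hmono ⟨le_rfl, zero_le_one⟩ hz h0.le
  simp only [Real.zero_rpow (show N / 2 ≠ 0 by linarith), mul_zero, zero_mul, sub_zero] at h5
  have h6 : 0 < z ^ (N / 2) := Real.rpow_pos_of_pos h0 _
  by_contra hc
  push Not at hc
  nlinarith

lemma Del_neg (N : ℝ) (f : ℝ → ℝ) : Del N (fun x => - f x) = fun x => - Del N f x := by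
  have h1 : deriv (fun x => - f x) = fun x => - deriv f x := by
    funext x; exact deriv.fun_neg
  have h2 : deriv (fun x => - deriv f x) = fun x => - deriv (deriv f) x := by
    funext x; exact deriv.fun_neg
  funext x
  simp only [Del, h1, h2]
  ring

lemma abs_deriv_le (N : ℝ) (hN : 4 ≤ N) {f : ℝ → ℝ} (hf : ContDiff ℝ (⊤ : ℕ∞) f) (S : ℝ)
    (hS : ∀ z ∈ Icc (0:ℝ) 1, |Del N f z| ≤ S) (z : ℝ) (hz : z ∈ Icc (0:ℝ) 1) :
    |deriv f z| ≤ S / (N / 2) := by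
  rw [abs_le]
  constructor
  · have h := deriv_le_aux N hN (f := fun x => - f x) hf.neg S ?_ z hz
    · have h1 : deriv (fun x => - f x) z = - deriv f z := deriv.fun_neg
      rw [h1] at h
      linarith
    · intro x hx
      rw [Del_neg]
      have := (abs_le.mp (hS x hx)).1
      simp only
      linarith
  · exact deriv_le_aux N hN hf S (fun x hx => (abs_le.mp (hS x hx)).2) z hz

/-- Control of the weighted derivatives by `Δ^m`. -/
lemma weighted_le (m : ℕ) : ∀ N : ℝ, 4 ≤ N → ∃ C : ℝ, 0 ≤ C ∧ ∀ f : ℝ → ℝ,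
    ContDiff ℝ (⊤ : ℕ∞) f → ∀ S : ℝ, (∀ z ∈ Icc (0:ℝ) 1, |DelIter N m f z| ≤ S) →
    ∀ j ≤ m, ∀ z ∈ Icc (0:ℝ) 1, |z ^ j * iteratedDeriv (m + j) f z| ≤ C * S := by
  induction m with
  | zero =>
    intro N hN
    refine ⟨1, zero_le_one, fun f hf S hS j hj z hz => ?_⟩
    obtain rfl : j = 0 := by omega
    simpa [DelIter] using hS z hz
  | succ m ih =>
    intro N hN
    obtain ⟨C1, hC1, h1⟩ := ih N hN
    obtain ⟨C2, hC2, h2⟩ := ih (N + 2) (by linarith)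
    have hN0 : 0 < N / 2 := by linarith
    refine ⟨C1 + (1 + 2 * m + N / 2) * (C2 / (N / 2)), by positivity, fun f hf S hS => ?_⟩
    have hS0 : 0 ≤ S := (abs_nonneg _).trans (hS 0 ⟨le_rfl, zero_le_one⟩)
    have key : ∀ j ≤ m, ∀ z ∈ Icc (0:ℝ) 1,
        |z ^ j * iteratedDeriv (m + 1 + j) f z| ≤ C2 / (N / 2) * S := by
      intro j hj z hz
      have h3 := h2 (deriv f) (sm_deriv hf) (S / (N / 2)) (fun x hx => by
        rw [← deriv_DelIter N m hf]
        exact abs_deriv_le N hN (sm_DelIter N m hf) S hS x hx) j hj z hz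
      rw [← iteratedDeriv_succ', show m + j + 1 = m + 1 + j by ring] at h3
      calc _ ≤ _ := h3
        _ = _ := by ring
    have hA : 0 ≤ C2 / (N / 2) * S := by positivity
    have hB : 0 ≤ C1 * S := by positivity
    intro j hj z hz
    rcases Nat.lt_or_ge m j with hjm | hjm
    · obtain rfl : j = m + 1 := by omega
      have h4 := h1 (Del N f) (sm_Del N hf) S (fun x hx => by
        rw [← DelIter_succ']; exact hS x hx) m le_rfl z hz
      have h5 := key m le_rfl z hz
      rw [iter_Del N hf] at h4
      have e : z ^ (m + 1) * iteratedDeriv (m + 1 + (m + 1)) f z =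
        z ^ m * (z * iteratedDeriv (m + m + 2) f z + (((m + m : ℕ) : ℝ) + N / 2) *
          iteratedDeriv (m + m + 1) f z)
          - (2 * m + N / 2) * (z ^ m * iteratedDeriv (m + 1 + m) f z) := by
        rw [show m + 1 + (m + 1) = m + m + 2 by ring, show m + 1 + m = m + m + 1 by ring]
        push_cast
        ring
      rw [e]
      refine (abs_sub _ _).trans ?_
      rw [abs_mul (2 * (m:ℝ) + N / 2), abs_of_nonneg (show 0 ≤ 2 * (m:ℝ) + N / 2 by positivity)]
      have h6 := mul_le_mul_of_nonneg_left h5 (show 0 ≤ 2 * (m:ℝ) + N / 2 by positivity)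
      nlinarith
    · have h5 := key j hjm z hz
      have : 0 ≤ (2 * m + N / 2) * (C2 / (N / 2) * S) := by positivity
      nlinarith

/-- Control of `Δ^m` by the weighted derivatives. -/
lemma DelIter_le (N : ℝ) (hN : 4 ≤ N) (m : ℕ) : ∃ C : ℝ, 0 ≤ C ∧ ∀ f : ℝ → ℝ,
    ContDiff ℝ (⊤ : ℕ∞) f → ∀ z B : ℝ, (∀ j ≤ m, |z ^ j * iteratedDeriv (m + j) f z| ≤ B) →
    |DelIter N m f z| ≤ C * B := by
  induction m with
  | zero =>
    refine ⟨1, zero_le_one, fun f hf z B hB => ?_⟩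
    simpa [DelIter] using hB 0 le_rfl
  | succ m ih =>
    obtain ⟨C, hC, h⟩ := ih
    refine ⟨C * (1 + 2 * m + N / 2), by positivity, fun f hf z B hB => ?_⟩
    rw [DelIter_succ', mul_assoc]
    apply h _ (sm_Del N hf)
    intro j hj
    have hB0 : 0 ≤ B := (abs_nonneg _).trans (hB 0 (by omega))
    have h1 := hB (j + 1) (by omega)
    have h2 := hB j (by omega)
    rw [iter_Del N hf]
    have e : z ^ j * (z * iteratedDeriv (m + j + 2) f z + (((m + j : ℕ) : ℝ) + N / 2) *
          iteratedDeriv (m + j + 1) f z) = z ^ (j + 1) * iteratedDeriv (m + 1 + (j + 1)) f z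
          + (m + j + N / 2) * (z ^ j * iteratedDeriv (m + 1 + j) f z) := by
      rw [show m + 1 + (j + 1) = m + j + 2 by ring, show m + 1 + j = m + j + 1 by ring]
      push_cast
      ring
    simp only
    rw [e]
    refine (abs_add_le _ _).trans ?_
    have h0 : 0 ≤ (m:ℝ) + j + N / 2 := by positivity
    rw [abs_mul ((m:ℝ) + j + N / 2), abs_of_nonneg h0]
    have h6 := mul_le_mul_of_nonneg_left h2 h0
    have h7 : (j:ℝ) ≤ m := by exact_mod_cast hj
    nlinarith

/-- Pointwise composition estimate. -/
lemma comp_le (C₀ B : ℝ) (hB : 0 ≤ B) (K : ℕ) (n : ℕ) (hn : n ≤ K) :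
    ∀ G : ℝ × ℝ → ℝ, ContDiff ℝ (⊤ : ℕ∞) G →
    ∃ C : ℝ, 0 ≤ C ∧ ∀ y : ℝ → ℝ, ContDiff ℝ (⊤ : ℕ∞) y → ∀ z ∈ Icc (0:ℝ) 1, |y z| ≤ C₀ →
      ∀ w L : ℝ, 0 ≤ w → w ≤ 1 → 1 ≤ L →
      (∀ b, 1 ≤ b → b ≤ K → w ^ b * |iteratedDeriv b y z| ≤ B * L ^ b) →
      w ^ n * |iteratedDeriv n (fun x => G (x, y x)) z| ≤ C * L ^ n := by
  induction n using Nat.strong_induction_on with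
  | _ n ih =>
  intro G hG
  rcases n with _ | n
  · obtain ⟨C, hC⟩ := ((isCompact_Icc (a := (0:ℝ)) (b := 1)).prod
      (isCompact_Icc (a := -C₀) (b := C₀))).exists_bound_of_continuousOn hG.continuous.continuousOn
    refine ⟨|C|, abs_nonneg _, fun y hy z hz hyz w L _ _ _ _ => ?_⟩
    have := hC (z, y z) ⟨hz, abs_le.mp hyz⟩
    simp only [pow_zero, iteratedDeriv_zero, one_mul, mul_one]
    exact this.trans (le_abs_self C)
  · have hG' : ∀ v : ℝ × ℝ, ContDiff ℝ (⊤ : ℕ∞) (fun p => fderiv ℝ G p v) := fun v =>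
      (hG.fderiv_right (by simp)).clm_apply contDiff_const
    obtain ⟨C1, hC1, h1⟩ := ih n (by omega) (by omega) _ (hG' (1, 0))
    have h2' : ∀ i, ∃ C : ℝ, 0 ≤ C ∧ (i ≤ n → ∀ y : ℝ → ℝ, ContDiff ℝ (⊤ : ℕ∞) y →
        ∀ z ∈ Icc (0:ℝ) 1, |y z| ≤ C₀ →
        ∀ w L : ℝ, 0 ≤ w → w ≤ 1 → 1 ≤ L →
        (∀ b, 1 ≤ b → b ≤ K → w ^ b * |iteratedDeriv b y z| ≤ B * L ^ b) →
        w ^ i * |iteratedDeriv i (fun x => fderiv ℝ G (x, y x) (0, 1)) z| ≤ C * L ^ i) := by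
      intro i
      by_cases hi : i ≤ n
      · obtain ⟨C, hC, h⟩ := ih i (by omega) (by omega) _ (hG' (0, 1))
        exact ⟨C, hC, fun _ => h⟩
      · exact ⟨0, le_rfl, fun h => absurd h hi⟩
    choose C2 hC2 h2 using h2'
    refine ⟨C1 + ∑ i ∈ Finset.range (n + 1), n.choose i * C2 i * B,
      add_nonneg hC1 (Finset.sum_nonneg fun i _ => by have := hC2 i; positivity),
      fun y hy z hz hyz w L hw0 hw1 hL hb => ?_⟩
    have hpair : ContDiff ℝ (⊤ : ℕ∞) (fun x => (x, y x)) := contDiff_id.prodMk hy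
    have hder : deriv (fun x => G (x, y x)) =
        (fun x => fderiv ℝ G (x, y x) (1, 0)) +
          (fun x => fderiv ℝ G (x, y x) (0, 1)) * deriv y := by
      funext x
      have e1 : HasFDerivAt G (fderiv ℝ G (x, y x)) (x, y x) :=
        (hG.differentiable (by simp) _).hasFDerivAt
      have e2 : HasDerivAt (fun x => (x, y x)) ((1:ℝ), deriv y x) x :=
        (hasDerivAt_id x).prodMk (sm_diff hy x).hasDerivAt
      have e3 := e1.comp_hasDerivAt x e2
      have e4 : deriv (fun x => G (x, y x)) x = _ := e3.deriv
      rw [e4]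
      have : ((1:ℝ), deriv y x) = (1, 0) + deriv y x • ((0:ℝ), (1:ℝ)) := by simp
      rw [this, map_add, map_smul]
      simp only [Pi.add_apply, Pi.mul_apply, smul_eq_mul]
      ring
    have s1 : ContDiff ℝ (⊤ : ℕ∞) (fun x => fderiv ℝ G (x, y x) (1, 0)) :=
      (hG' (1, 0)).comp hpair
    have s2 : ContDiff ℝ (⊤ : ℕ∞) (fun x => fderiv ℝ G (x, y x) (0, 1)) :=
      (hG' (0, 1)).comp hpair
    have s3 := sm_deriv hy
    have s4 : ContDiff ℝ (⊤ : ℕ∞) ((fun x => fderiv ℝ G (x, y x) (0, 1)) * deriv y) :=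
      s2.mul s3
    have le : ((n : ℕ) : WithTop ℕ∞) ≤ ((⊤ : ℕ∞) : WithTop ℕ∞) := by
      exact_mod_cast le_top
    rw [iteratedDeriv_succ', hder, iteratedDeriv_add (s1.of_le le).contDiffAt
      (s4.of_le le).contDiffAt, iteratedDeriv_mul (s2.of_le le).contDiffAt
      (s3.of_le le).contDiffAt, add_mul, Finset.sum_mul]
    have hwn : 0 ≤ w ^ (n + 1) := by positivity
    refine (mul_le_mul_of_nonneg_left ((abs_add_le _ _).trans
      (add_le_add_right (Finset.abs_sum_le_sum_abs _ _) _)) hwn).trans ?_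
    rw [mul_add, Finset.mul_sum]
    refine add_le_add ?_ (Finset.sum_le_sum fun i hi => ?_)
    · have h3 := h1 y hy z hz hyz w L hw0 hw1 hL hb
      have hL0 : 0 ≤ L ^ n := by positivity
      calc w ^ (n + 1) * |iteratedDeriv n (fun x => fderiv ℝ G (x, y x) (1, 0)) z|
          = w * (w ^ n * |iteratedDeriv n (fun x => fderiv ℝ G (x, y x) (1, 0)) z|) := by ring
        _ ≤ 1 * (C1 * L ^ n) := mul_le_mul hw1 h3 (by positivity) zero_le_one
        _ ≤ L * (C1 * L ^ n) := mul_le_mul_of_nonneg_right hL (by positivity)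
        _ = C1 * L ^ (n + 1) := by ring
    · have hi' : i ≤ n := by have := Finset.mem_range.mp hi; omega
      have h3 := h2 i hi' y hy z hz hyz w L hw0 hw1 hL hb
      have h4 := hb (n - i + 1) (by omega) (by omega)
      rw [abs_mul, abs_mul, ← iteratedDeriv_succ', Nat.abs_cast]
      have ew : w ^ (n + 1) = w ^ i * w ^ (n - i + 1) := by
        rw [← pow_add]; congr 1; omega
      have eL : L ^ (n + 1) = L ^ i * L ^ (n - i + 1) := by
        rw [← pow_add]; congr 1; omega
      rw [ew, eL]
      have h5 := mul_le_mul h3 h4 (by positivity) (by have := hC2 i; positivity)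
      calc _ = (n.choose i : ℝ) * ((w ^ i *
            |iteratedDeriv i (fun x => fderiv ℝ G (x, y x) (0, 1)) z|) *
            (w ^ (n - i + 1) * |iteratedDeriv (n - i + 1) y z|)) := by ring
        _ ≤ (n.choose i : ℝ) * ((C2 i * L ^ i) * (B * L ^ (n - i + 1))) :=
          mul_le_mul_of_nonneg_left h5 (by positivity)
        _ = _ := by ring

lemma landau_unit (n : ℕ) : ∃ C : ℝ, 0 ≤ C ∧ ∀ g : ℝ → ℝ, ContDiff ℝ (⊤ : ℕ∞) g → ∀ A M : ℝ,
    (∀ t ∈ Icc (0:ℝ) 1, |g t| ≤ A) → (∀ t ∈ Icc (0:ℝ) 1, |iteratedDeriv (n + 1) g t| ≤ M) →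
    ∀ b ≤ n, |iteratedDeriv b g 0| ≤ C * (A + M) := by
  set v : ℕ → ℝ := fun i => ((i:ℝ) + 1) / (n + 1) with hv
  set s := Finset.range (n + 1) with hs
  have hn : (0:ℝ) < n + 1 := by positivity
  have hinj : Set.InjOn v s := by
    intro i _ j _ hij
    simp only [hv] at hij
    rw [div_left_inj' hn.ne'] at hij
    exact_mod_cast add_right_cancel hij
  set cc : ℕ → ℝ := fun b => ∑ i ∈ s, |(Lagrange.basis s v i).coeff b| with hcc
  have hcc0 : ∀ b, 0 ≤ cc b := fun b => Finset.sum_nonneg fun i _ => abs_nonneg _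
  refine ⟨∑ b ∈ s, (b.factorial : ℝ) * cc b,
    Finset.sum_nonneg fun b _ => by have := hcc0 b; positivity, ?_⟩
  intro g hg A M hA hM b hb
  have hA0 : 0 ≤ A := (abs_nonneg _).trans (hA 0 ⟨le_rfl, zero_le_one⟩)
  have hM0 : 0 ≤ M := (abs_nonneg _).trans (hM 0 ⟨le_rfl, zero_le_one⟩)
  set P : Polynomial ℝ := ∑ k ∈ s, Polynomial.monomial k
    ((k.factorial : ℝ)⁻¹ * iteratedDeriv k g 0) with hP
  have hcoeff : ∀ k ≤ n, P.coeff k = (k.factorial : ℝ)⁻¹ * iteratedDeriv k g 0 := by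
    intro k hk
    rw [hP, Polynomial.finsetSum_coeff]
    simp only [Polynomial.coeff_monomial]
    rw [Finset.sum_ite_eq' s k, if_pos (Finset.mem_range.mpr (by omega))]
  have hdeg : P.degree < s.card := by
    rw [hs, Finset.card_range]
    refine lt_of_le_of_lt (Polynomial.degree_sum_le _ _) ?_
    rw [Finset.sup_lt_iff (WithBot.bot_lt_coe _)]
    intro k hk
    refine lt_of_le_of_lt (Polynomial.degree_monomial_le _ _) ?_
    exact_mod_cast Finset.mem_range.mp hk
  have heval : ∀ i ∈ s, |P.eval (v i)| ≤ A + M := by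
    intro i hi
    have hi' : (i:ℝ) + 1 ≤ n + 1 := by exact_mod_cast Finset.mem_range.mp hi
    have h0 : 0 < v i := by simp only [hv]; positivity
    have h1 : v i ≤ 1 := by simp only [hv]; rw [div_le_one hn]; exact hi'
    have le : ∀ q : ℕ, ((q : ℕ) : WithTop ℕ∞) ≤ ((⊤ : ℕ∞) : WithTop ℕ∞) := fun q => by
      exact_mod_cast le_top
    obtain ⟨x, hx, hxe⟩ := taylor_mean_remainder_lagrange_iteratedDeriv (f := g) (n := n)
      (x₀ := 0) (x := v i) h0.ne ((hg.of_le (by exact_mod_cast le (n + 1))).contDiffOn)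
    have e : taylorWithinEval g n (uIcc 0 (v i)) 0 (v i) = P.eval (v i) := by
      rw [taylor_within_apply, hP, Polynomial.eval_finsetSum]
      refine Finset.sum_congr rfl fun k hk => ?_
      rw [iteratedDerivWithin_eq_iteratedDeriv (uniqueDiffOn_uIcc h0.ne)
        (hg.of_le (le k)).contDiffAt (left_mem_uIcc), Polynomial.eval_monomial]
      simp only [sub_zero, smul_eq_mul]
      ring
    rw [e] at hxe
    rw [uIoo_of_lt h0] at hx
    have h2 := hA (v i) ⟨h0.le, h1⟩
    have h3 := hM x ⟨hx.1.le, hx.2.le.trans h1⟩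
    have e2 : P.eval (v i) = g (v i) -
      iteratedDeriv (n + 1) g x * (v i - 0) ^ (n + 1) / ((n + 1).factorial : ℝ) := by
      rw [← hxe]; ring
    rw [e2]
    refine (abs_sub _ _).trans (add_le_add h2 ?_)
    have hf : (1:ℝ) ≤ ((n + 1).factorial : ℝ) := by exact_mod_cast Nat.factorial_pos (n + 1)
    rw [abs_div, abs_mul, sub_zero, abs_of_nonneg (by positivity : 0 ≤ v i ^ (n + 1)), Nat.abs_cast]
    have h4 : v i ^ (n + 1) ≤ 1 := pow_le_one₀ h0.le h1
    refine (div_le_self (by positivity) hf).trans ?_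
    calc _ ≤ M * 1 := mul_le_mul h3 h4 (by positivity) hM0
      _ = M := mul_one M
  have hPc : |P.coeff b| ≤ cc b * (A + M) := by
    rw [Lagrange.eq_interpolate hinj hdeg, Lagrange.interpolate_apply, Polynomial.finsetSum_coeff,
      hcc, Finset.sum_mul]
    refine (Finset.abs_sum_le_sum_abs _ _).trans (Finset.sum_le_sum fun i hi => ?_)
    rw [Polynomial.coeff_C_mul, abs_mul, mul_comm]
    exact mul_le_mul_of_nonneg_left (heval i hi) (abs_nonneg _)
  have hfb : (0:ℝ) < b.factorial := by exact_mod_cast Nat.factorial_pos b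
  have e3 : iteratedDeriv b g 0 = b.factorial * P.coeff b := by
    rw [hcoeff b hb]; field_simp
  rw [e3, abs_mul, Nat.abs_cast]
  have hbs : b ∈ s := Finset.mem_range.mpr (by omega)
  have h5 := Finset.single_le_sum (f := fun b => (b.factorial : ℝ) * cc b)
    (fun b _ => by have := hcc0 b; positivity) hbs
  calc _ ≤ (b.factorial : ℝ) * (cc b * (A + M)) := mul_le_mul_of_nonneg_left hPc hfb.le
    _ = ((b.factorial : ℝ) * cc b) * (A + M) := by ring
    _ ≤ _ := mul_le_mul_of_nonneg_right h5 (by positivity)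

lemma landau (n : ℕ) : ∃ C : ℝ, 0 ≤ C ∧ ∀ f : ℝ → ℝ, ContDiff ℝ (⊤ : ℕ∞) f → ∀ x h A M : ℝ,
    (∀ t ∈ Icc (0:ℝ) 1, |f (x + h * t)| ≤ A) →
    (∀ t ∈ Icc (0:ℝ) 1, |iteratedDeriv (n + 1) f (x + h * t)| ≤ M) →
    ∀ b ≤ n, |h| ^ b * |iteratedDeriv b f x| ≤ C * (A + |h| ^ (n + 1) * M) := by
  obtain ⟨C, hC, H⟩ := landau_unit n
  refine ⟨C, hC, fun f hf x h A M hA hM b hb => ?_⟩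
  have hfx : ContDiff ℝ (⊤ : ℕ∞) (fun t => f (x + t)) := hf.comp (contDiff_const.add contDiff_id)
  have hg : ContDiff ℝ (⊤ : ℕ∞) (fun t => f (x + h * t)) :=
    hf.comp (contDiff_const.add (contDiff_const.mul contDiff_id))
  have e : ∀ k t, iteratedDeriv k (fun t => f (x + h * t)) t
      = h ^ k * iteratedDeriv k f (x + h * t) := by
    intro k t
    have h1 := iteratedDeriv_comp_const_mul (n := k) (f := fun t => f (x + t))
      (hfx.of_le (by exact_mod_cast le_top)) h
    rw [iteratedDeriv_comp_const_add] at h1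
    exact congrFun h1 t
  have := H _ hg A (|h| ^ (n + 1) * M) hA (fun t ht => by
    rw [e, abs_mul, abs_pow]
    exact mul_le_mul_of_nonneg_left (hM t ht) (by positivity)) b hb
  rw [e, abs_mul, abs_pow] at this
  simpa using this

/-- Weighted interpolation. -/
lemma interp (k j : ℕ) (hj : j ≤ k) (hk : 1 ≤ k) (C₀ C₁ : ℝ) (hC₀ : 0 ≤ C₀) (hC₁ : 0 ≤ C₁) :
    ∃ B : ℝ, 0 ≤ B ∧ ∀ y : ℝ → ℝ, ContDiff ℝ (⊤ : ℕ∞) y → (∀ z ∈ Icc (0:ℝ) 1, |y z| ≤ C₀) →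
    ∀ L : ℝ, 1 ≤ L → (∀ z ∈ Icc (0:ℝ) 1, |z ^ j * iteratedDeriv k y z| ≤ C₁ * L ^ k) →
    ∀ z ∈ Icc (0:ℝ) 1, ∀ b, 1 ≤ b → b ≤ k →
      (z ^ ((j:ℝ) / k)) ^ b * |iteratedDeriv b y z| ≤ B * L ^ b := by
  obtain ⟨n, rfl⟩ : ∃ n, k = n + 1 := ⟨k - 1, by omega⟩
  obtain ⟨C, hC, H⟩ := landau n
  refine ⟨C₁ + 4 ^ (n + 1) * (C * (C₀ + C₁)), by positivity, ?_⟩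
  intro y hy hy0 L hL hyk z hz b hb1 hbk
  set θ : ℝ := (j:ℝ) / ((n + 1 : ℕ) : ℝ) with hθ
  have hθ0 : 0 ≤ θ := by positivity
  have hθ1 : θ ≤ 1 := by
    rw [hθ, div_le_one (by positivity)]; exact_mod_cast hj
  have hL0 : 0 < L := by linarith
  have hpow : ∀ x : ℝ, 0 ≤ x → (x ^ θ) ^ (n + 1) = x ^ j := by
    intro x hx
    rw [← Real.rpow_natCast, ← Real.rpow_mul hx, hθ, div_mul_cancel₀ _ (by positivity),
      Real.rpow_natCast]
  rcases Nat.lt_or_ge n b with hbn | hbn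
  · obtain rfl : b = n + 1 := by omega
    have h1 := hyk z hz
    rw [abs_mul, abs_of_nonneg (pow_nonneg hz.1 j), ← hpow z hz.1] at h1
    refine h1.trans (mul_le_mul_of_nonneg_right ?_ (by positivity))
    have : 0 ≤ 4 ^ (n + 1) * (C * (C₀ + C₁)) := by positivity
    linarith
  have hw0 : 0 ≤ z ^ θ := Real.rpow_nonneg hz.1 _
  have hw1 : z ^ θ ≤ 1 := Real.rpow_le_one hz.1 hz.2 hθ0
  rcases eq_or_lt_of_le hw0 with hw | hw
  · rw [← hw, zero_pow (by omega), zero_mul]; positivity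
  set w := z ^ θ with hwdef
  obtain ⟨h, habs, hmem⟩ : ∃ h : ℝ, |h| = w / (4 * L) ∧ ∀ t ∈ Icc (0:ℝ) 1,
      z + h * t ∈ Icc (0:ℝ) 1 ∧ w / 2 ≤ (z + h * t) ^ θ := by
    have hd0 : 0 < w / (4 * L) := by positivity
    have hd1 : w / (4 * L) ≤ 1 / 4 := by
      rw [div_le_div_iff₀ (by positivity) (by norm_num)]; nlinarith
    rcases le_total z (1 / 2) with hz2 | hz2
    · refine ⟨w / (4 * L), abs_of_pos hd0, fun t ht => ?_⟩
      have ht0 : 0 ≤ w / (4 * L) * t := mul_nonneg hd0.le ht.1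
      have ht1 : w / (4 * L) * t ≤ 1 / 4 := by nlinarith [ht.1, ht.2]
      refine ⟨⟨by linarith [hz.1], by linarith⟩, ?_⟩
      have : w ≤ (z + w / (4 * L) * t) ^ θ :=
        Real.rpow_le_rpow hz.1 (by linarith) hθ0
      linarith
    · refine ⟨-(w / (4 * L)), by rw [abs_neg, abs_of_pos hd0], fun t ht => ?_⟩
      have ht0 : 0 ≤ w / (4 * L) * t := mul_nonneg hd0.le ht.1
      have ht1 : w / (4 * L) * t ≤ 1 / 4 := by nlinarith [ht.1, ht.2]
      have hm : z + -(w / (4 * L)) * t ∈ Icc (0:ℝ) 1 :=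
        ⟨by linarith, by linarith [hz.2]⟩
      refine ⟨hm, ?_⟩
      -- left of the point the weight is at least `1/2 ≥ w/2` up to a fixed factor
      have h5 : (z * (1 / 2)) ^ θ ≤ (z + -(w / (4 * L)) * t) ^ θ :=
        Real.rpow_le_rpow (by linarith) (by linarith) hθ0
      rw [Real.mul_rpow hz.1 (by norm_num)] at h5
      have h6 : (1 / 2 : ℝ) ^ (1:ℝ) ≤ (1 / 2 : ℝ) ^ θ :=
        Real.rpow_le_rpow_of_exponent_ge (by norm_num) (by norm_num) hθ1
      rw [Real.rpow_one] at h6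
      have h7 : w * (1 / 2) ≤ w * (1 / 2 : ℝ) ^ θ := mul_le_mul_of_nonneg_left h6 hw.le
      linarith
  have hM : ∀ t ∈ Icc (0:ℝ) 1, |iteratedDeriv (n + 1) y (z + h * t)|
      ≤ C₁ * L ^ (n + 1) / (w / 2) ^ (n + 1) := by
    intro t ht
    obtain ⟨h1, h2⟩ := hmem t ht
    have h3 := hyk _ h1
    rw [abs_mul, abs_of_nonneg (pow_nonneg h1.1 j), ← hpow _ h1.1] at h3
    rw [le_div_iff₀ (by positivity), mul_comm]
    refine le_trans (mul_le_mul_of_nonneg_right ?_ (abs_nonneg _)) h3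
    exact pow_le_pow_left₀ (by positivity) h2 _
  have key := H y hy z h C₀ _ (fun t ht => hy0 _ (hmem t ht).1) hM b hbn
  rw [habs] at key
  have e1 : (w / (4 * L)) ^ (n + 1) * (C₁ * L ^ (n + 1) / (w / 2) ^ (n + 1))
      = C₁ * (1 / 2) ^ (n + 1) := by
    have : (w / (4 * L)) = (1 / 2) * (w / 2) / L := by field_simp; norm_num
    rw [this, div_pow, mul_pow]
    field_simp
  have e2 : C₁ * (1 / 2 : ℝ) ^ (n + 1) ≤ C₁ * 1 :=
    mul_le_mul_of_nonneg_left (pow_le_one₀ (by norm_num) (by norm_num)) hC₁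
  rw [e1] at key
  have key2 : (w / (4 * L)) ^ b * |iteratedDeriv b y z| ≤ C * (C₀ + C₁) :=
    key.trans (mul_le_mul_of_nonneg_left (by linarith) hC)
  have e3 : w ^ b * |iteratedDeriv b y z|
      = (4 ^ b * L ^ b) * ((w / (4 * L)) ^ b * |iteratedDeriv b y z|) := by
    rw [div_pow, mul_pow]; field_simp
  rw [e3]
  have e4 : (4:ℝ) ^ b ≤ 4 ^ (n + 1) := pow_le_pow_right₀ (by norm_num) (by omega)
  have hQ : 0 ≤ C * (C₀ + C₁) := by positivity
  calc _ ≤ (4 ^ b * L ^ b) * (C * (C₀ + C₁)) := mul_le_mul_of_nonneg_left key2 (by positivity)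
    _ = 4 ^ b * (C * (C₀ + C₁)) * L ^ b := by ring
    _ ≤ 4 ^ (n + 1) * (C * (C₀ + C₁)) * L ^ b := by gcongr
    _ ≤ _ := by
      refine mul_le_mul_of_nonneg_right ?_ (by positivity)
      linarith

lemma le_supN {f : ℝ → ℝ} (hf : Continuous f) (z : ℝ) (hz : z ∈ Icc (0:ℝ) 1) :
    |f z| ≤ supN f := by
  obtain ⟨C, hC⟩ := (isCompact_Icc (a := (0:ℝ)) (b := 1)).exists_bound_of_continuousOn
    hf.continuousOn
  have hb : BddAbove (Set.range fun z : Icc (0:ℝ) 1 => |f z.1|) :=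
    ⟨C, by rintro _ ⟨x, rfl⟩; exact hC x.1 x.2⟩
  exact le_ciSup hb ⟨z, hz⟩

theorem stmt7 (N : ℝ) (hN : 4 ≤ N) (F : ℝ → ℝ → ℝ)
    (hF : ContDiff ℝ (⊤ : ℕ∞) fun p : ℝ × ℝ => F p.1 p.2)
    (C₀ : ℝ) (hC₀ : 0 < C₀) (m : ℕ) (hm : 1 ≤ m) :
    ∃ C > (0:ℝ), ∀ y : ℝ → ℝ, ContDiff ℝ (⊤ : ℕ∞) y → supN y ≤ C₀ →
      supN (DelIter N m fun z => F z (y z))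
        ≤ C * (1 + ⨆ j : Fin (m + 1), supN (DelIter N j.1 y)) := by
  obtain ⟨C1, hC1, h1⟩ := weighted_le m N hN
  obtain ⟨C2, hC2, h2⟩ := DelIter_le N hN m
  have h3 : ∀ j, ∃ C : ℝ, 0 ≤ C ∧ (j ≤ m → ∀ y : ℝ → ℝ, ContDiff ℝ (⊤ : ℕ∞) y →
      (∀ z ∈ Icc (0:ℝ) 1, |y z| ≤ C₀) → ∀ S : ℝ, 0 ≤ S →
      (∀ z ∈ Icc (0:ℝ) 1, |DelIter N m y z| ≤ S) →
      ∀ z ∈ Icc (0:ℝ) 1, |z ^ j * iteratedDeriv (m + j) (fun z => F z (y z)) z|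
        ≤ C * (1 + S)) := by
    intro j
    by_cases hj : j ≤ m
    swap
    · exact ⟨0, le_rfl, fun h => absurd h hj⟩
    obtain ⟨B, hB, hI⟩ := interp (m + j) j (by omega) (by omega) C₀ C1 hC₀.le hC1
    obtain ⟨C, hC, hc⟩ := comp_le C₀ B hB (m + j) (m + j) le_rfl (fun p => F p.1 p.2) hF
    refine ⟨C, hC, fun _ y hy hy0 S hS0 hS z hz => ?_⟩
    have hk0 : ((m + j : ℕ) : ℝ) ≠ 0 := by
      have : m + j ≠ 0 := by omega
      exact_mod_cast this
    set L : ℝ := (1 + S) ^ ((1:ℝ) / ((m + j : ℕ) : ℝ)) with hLdef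
    have hLp : L ^ (m + j) = 1 + S := by
      rw [hLdef, ← Real.rpow_natCast, ← Real.rpow_mul (by linarith), div_mul_cancel₀ _ hk0,
        Real.rpow_one]
    have hL1 : 1 ≤ L := Real.one_le_rpow (by linarith) (by positivity)
    have hw0 : 0 ≤ z ^ ((j:ℝ) / ((m + j : ℕ) : ℝ)) := Real.rpow_nonneg hz.1 _
    have hw1 : z ^ ((j:ℝ) / ((m + j : ℕ) : ℝ)) ≤ 1 :=
      Real.rpow_le_one hz.1 hz.2 (by positivity)
    have hwp : (z ^ ((j:ℝ) / ((m + j : ℕ) : ℝ))) ^ (m + j) = z ^ j := by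
      rw [← Real.rpow_natCast, ← Real.rpow_mul hz.1, div_mul_cancel₀ _ hk0, Real.rpow_natCast]
    have h4 := hI y hy hy0 L hL1 (fun x hx => by
      refine (h1 y hy S hS j hj x hx).trans ?_
      rw [hLp]
      exact mul_le_mul_of_nonneg_left (by linarith) hC1) z hz
    have h5 := hc y hy z hz (hy0 z hz) _ L hw0 hw1 hL1 h4
    rw [hwp, hLp] at h5
    rw [abs_mul, abs_of_nonneg (pow_nonneg hz.1 j)]
    exact h5
  choose C3 hC3 h3 using h3
  have hsum : 0 ≤ ∑ j ∈ Finset.range (m + 1), C3 j := Finset.sum_nonneg fun j _ => hC3 j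
  refine ⟨1 + C2 * ∑ j ∈ Finset.range (m + 1), C3 j, by positivity, fun y hy hy0 => ?_⟩
  set S : ℝ := ⨆ j : Fin (m + 1), supN (DelIter N j.1 y) with hSdef
  have hle : supN (DelIter N m y) ≤ S :=
    le_ciSup (f := fun j : Fin (m + 1) => supN (DelIter N j.1 y))
      (Set.finite_range _).bddAbove (Fin.last m)
  have hS : ∀ z ∈ Icc (0:ℝ) 1, |DelIter N m y z| ≤ S := fun z hz =>
    (le_supN (sm_DelIter N m hy).continuous z hz).trans hle
  have hS0 : 0 ≤ S := (abs_nonneg _).trans (hS 0 ⟨le_rfl, zero_le_one⟩)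
  have hyb : ∀ z ∈ Icc (0:ℝ) 1, |y z| ≤ C₀ := fun z hz => (le_supN hy.continuous z hz).trans hy0
  have hcomp : ContDiff ℝ (⊤ : ℕ∞) (fun z => F z (y z)) := hF.comp (contDiff_id.prodMk hy)
  haveI : Nonempty (Icc (0:ℝ) 1) := ⟨⟨0, le_rfl, zero_le_one⟩⟩
  refine ciSup_le fun z => ?_
  have h6 := h2 _ hcomp z.1 ((∑ j ∈ Finset.range (m + 1), C3 j) * (1 + S)) (fun j hj => by
    refine (h3 j hj y hy hyb S hS0 hS z.1 z.2).trans ?_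
    refine mul_le_mul_of_nonneg_right ?_ (by linarith)
    exact Finset.single_le_sum (f := C3) (fun j _ => hC3 j) (Finset.mem_range.mpr (by omega)))
  refine h6.trans ?_
  rw [← mul_assoc]
  refine mul_le_mul_of_nonneg_right ?_ (by linarith)
  linarith
end
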